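/- (VOM derivative for the scale contaminated normal model.) Let g ≥ 1 be a natural number, ν > 0, t ∈ ℝ, and for ε ∈ [0,1] let F_ε = (1−ε)·Φ_{0,1} + ε·Φ_{0,ν} be the scale contaminated normal mixture. Then the function h(ε) = P_{F_ε^{⊗g}}( Σ_{i=1}^g Z_i² > t ) is differentiable at ε = 0 with h′(0) = g·∫_ℝ P( χ²_{g−1} > t − x² ) dΦ_{0,ν}(x) − g·P( χ²_g > t ). -/

import Mathlib

open MeasureTheory ProbabilityTheory

/-- The chi-square distribution with `m` degrees of freedom, i.e. the gamma distribution with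
shape `m/2` and rate `1/2`, with the convention that `χ²₀` is the Dirac mass at `0`. -/
noncomputable def chiSqMeasure (m : ℕ) : Measure ℝ :=
  if m = 0 then Measure.dirac 0 else gammaMeasure ((m : ℝ) / 2) (1 / 2)

section CharFun

open Complex

lemma ofReal_mul_cpow {x : ℝ} (hx : 0 < x) {z : ℂ} (hz : z ≠ 0) (a : ℂ) :
    ((x : ℂ) * z) ^ a = (x : ℂ) ^ a * z ^ a := by
  have hx' : (x : ℂ) ≠ 0 := by exact_mod_cast hx.ne'
  rw [cpow_def_of_ne_zero (mul_ne_zero hx' hz), cpow_def_of_ne_zero hx', cpow_def_of_ne_zero hz,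
    log_ofReal_mul hx hz, ofReal_log hx.le, add_mul, Complex.exp_add]

lemma ofReal_sub_mul_I_ne_zero {r : ℝ} (hr : 0 < r) (s : ℝ) : (r : ℂ) - s * I ≠ 0 := by
  intro h
  have := congrArg re h
  simp at this
  exact hr.ne' this

lemma complexMGF_gammaMeasure_ofReal {a r s : ℝ} (ha : 0 < a) (hr : 0 < r) (hs : s < r) :
    complexMGF id (gammaMeasure a r) s = (r / (r - s)) ^ (a : ℂ) := by
  have hb : (r : ℂ) - s ≠ 0 := by exact_mod_cast (sub_pos.2 hs).ne'
  have hΓ : Complex.Gamma a ≠ 0 := Complex.Gamma_ne_zero_of_re_pos (by simpa using ha)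
  rw [complexMGF, gammaMeasure, integral_withDensity_eq_integral_toReal_smul
    (f := gammaPDF a r) (measurable_gammaPDFReal a r).ennreal_ofReal (by simp [gammaPDF]),
    ← setIntegral_eq_integral_of_forall_compl_eq_zero (s := Set.Ici 0),
    integral_Ici_eq_integral_Ioi]
  · have key : ∀ x ∈ Set.Ioi (0 : ℝ), (gammaPDF a r x).toReal • cexp (s * (id x : ℝ)) =
        ((r : ℂ) ^ (a : ℂ) / Complex.Gamma a) *
          ((x : ℂ) ^ ((a : ℂ) - 1) * cexp (-((r - s : ℝ) * x))) := by
      intro x hx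
      have hx' : (0 : ℝ) ≤ x := le_of_lt hx
      rw [gammaPDF, ENNReal.toReal_ofReal (gammaPDFReal_nonneg ha hr x), gammaPDFReal, if_pos hx',
        real_smul, id]
      push_cast [ofReal_cpow hr.le, ofReal_cpow hx', Complex.Gamma_ofReal]
      rw [show -(((r : ℂ) - s) * x) = -(r * x) + s * x by ring, Complex.exp_add]
      ring
    rw [setIntegral_congr_fun measurableSet_Ioi key, integral_const_mul,
      Complex.integral_cpow_mul_exp_neg_mul_Ioi (by simpa using ha) (sub_pos.2 hs), ofReal_sub,
      div_eq_mul_one_div (r : ℂ) (r - s), ofReal_mul_cpow hr (one_div_ne_zero hb)]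
    field_simp
  · intro x hx
    rw [gammaPDF_of_neg (by simpa using hx)]
    simp

lemma Iio_subset_integrableExpSet_gammaMeasure {a r : ℝ} (ha : 0 < a) (hr : 0 < r) :
    Set.Iio r ⊆ integrableExpSet id (gammaMeasure a r) := by
  intro s hs
  have h := complexMGF_gammaMeasure_ofReal ha hr hs
  have hne : (r / (r - s : ℂ)) ^ (a : ℂ) ≠ 0 := by
    rw [Ne, cpow_eq_zero_iff, not_and_or]
    exact .inl (div_ne_zero (by exact_mod_cast hr.ne') (by exact_mod_cast (sub_pos.2 hs).ne'))
  rw [complexMGF_ofReal] at h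
  refine Integrable.of_integral_ne_zero fun h0 ↦ hne ?_
  rw [← h, mgf, h0, ofReal_zero]

lemma complexMGF_gammaMeasure {a r : ℝ} (ha : 0 < a) (hr : 0 < r) {z : ℂ} (hz : z.re < r) :
    complexMGF id (gammaMeasure a r) z = (r / (r - z)) ^ (a : ℂ) := by
  have hsub : Set.Iio r ⊆ interior (integrableExpSet id (gammaMeasure a r)) :=
    interior_maximal (Iio_subset_integrableExpSet_gammaMeasure ha hr) isOpen_Iio
  have hU : IsOpen {z : ℂ | z.re < r} := isOpen_lt continuous_re continuous_const
  have hf : AnalyticOnNhd ℂ (complexMGF id (gammaMeasure a r)) {z | z.re < r} :=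
    analyticOnNhd_complexMGF.mono fun w hw ↦ hsub hw
  have hg : AnalyticOnNhd ℂ (fun z : ℂ ↦ (r / (r - z)) ^ (a : ℂ)) {z | z.re < r} := by
    refine DifferentiableOn.analyticOnNhd (fun w hw ↦ ?_) hU
    have hw' : 0 < ((r : ℂ) - w).re := by simpa using hw
    have hw0 : (r : ℂ) - w ≠ 0 := fun h ↦ by simp [h] at hw'
    refine (DifferentiableAt.cpow_const (by fun_prop (disch := exact hw0))
      ?_).differentiableWithinAt
    left
    rw [div_eq_mul_inv, re_ofReal_mul, inv_re]
    exact mul_pos hr (div_pos hw' (normSq_pos.2 hw0))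
  refine hf.eqOn_of_preconnected_of_frequently_eq hg
    (convex_halfSpace_re_lt r).isPreconnected (z₀ := ((0 : ℝ) : ℂ)) (by simpa using hr) ?_ hz
  have h_real : ∃ᶠ x : ℝ in nhdsWithin 0 {0}ᶜ,
      complexMGF id (gammaMeasure a r) x = (r / (r - x)) ^ (a : ℂ) :=
    ((Filter.Eventually.filter_mono nhdsWithin_le_nhds (Iio_mem_nhds hr)).mono fun x hx ↦
      complexMGF_gammaMeasure_ofReal ha hr hx).frequently
  refine Filter.Tendsto.frequently (f := ((↑) : ℝ → ℂ)) ?_ h_real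
  refine tendsto_nhdsWithin_iff.2
    ⟨(continuous_ofReal.tendsto 0).mono_left nhdsWithin_le_nhds, ?_⟩
  filter_upwards [self_mem_nhdsWithin] with x hx
  simpa using hx

lemma charFun_gammaMeasure {a r : ℝ} (ha : 0 < a) (hr : 0 < r) (s : ℝ) :
    charFun (gammaMeasure a r) s = (r / (r - s * I)) ^ (a : ℂ) := by
  rw [← complexMGF_id_mul_I, complexMGF_gammaMeasure ha hr (by simpa using hr)]

lemma charFun_map_sq_gaussianReal (s : ℝ) :
    charFun ((gaussianReal 0 1).map (fun x ↦ x ^ 2)) s =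
      ((1 / 2 : ℝ) / ((1 / 2 : ℝ) - s * I)) ^ ((1 / 2 : ℝ) : ℂ) := by
  have hr : (0 : ℝ) < 1 / 2 := by norm_num
  have hb := ofReal_sub_mul_I_ne_zero hr s
  have h2π : (0 : ℝ) < 2 * Real.pi := by positivity
  rw [charFun_apply_real, integral_map (by fun_prop) (by fun_prop),
    integral_gaussianReal_eq_integral_smul one_ne_zero]
  have key : ∀ x : ℝ, gaussianPDFReal 0 1 x • cexp (s * (x ^ 2 : ℝ) * I) =
      ((√(2 * Real.pi) : ℝ) : ℂ)⁻¹ * cexp (-((1 / 2 : ℝ) - s * I) * (x : ℂ) ^ 2) := by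
    intro x
    rw [gaussianPDFReal, real_smul]
    push_cast
    rw [show -((1 / 2 : ℂ) - s * I) * x ^ 2 = -(x - 0) ^ 2 / (2 * 1) + s * x ^ 2 * I by ring,
      Complex.exp_add]
    simp only [mul_one]
    ring
  have hsqrt : ((√(2 * Real.pi) : ℝ) : ℂ) ≠ 0 := by
    exact_mod_cast (Real.sqrt_pos.2 h2π).ne'
  have hsplit : (Real.pi : ℂ) / ((1 / 2 : ℝ) - s * I) =
      ((2 * Real.pi : ℝ) : ℂ) * ((1 / 2 : ℝ) / ((1 / 2 : ℝ) - s * I)) := by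
    push_cast
    ring
  have hhalf : (1 / 2 : ℂ) = ((1 / 2 : ℝ) : ℂ) := by push_cast; rfl
  rw [integral_congr_ae (.of_forall key), integral_const_mul,
    integral_gaussian_complex (by simp), hsplit,
    ofReal_mul_cpow h2π (div_ne_zero (by norm_num) hb), hhalf, ← ofReal_cpow h2π.le,
    ← Real.sqrt_eq_rpow]
  field_simp

end CharFun

lemma gammaMeasure_conv_gammaMeasure {a b r : ℝ} (ha : 0 < a) (hb : 0 < b) (hr : 0 < r) :
    (gammaMeasure a r).conv (gammaMeasure b r) = gammaMeasure (a + b) r := by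
  have := isProbabilityMeasure_gammaMeasure ha hr
  have := isProbabilityMeasure_gammaMeasure hb hr
  have := isProbabilityMeasure_gammaMeasure (add_pos ha hb) hr
  refine Measure.ext_of_charFun (funext fun s ↦ ?_)
  have hr' : (r : ℂ) ≠ 0 := by exact_mod_cast hr.ne'
  rw [charFun_conv, charFun_gammaMeasure ha hr, charFun_gammaMeasure hb hr,
    charFun_gammaMeasure (add_pos ha hb) hr, Complex.ofReal_add,
    Complex.cpow_add _ _ (div_ne_zero hr' (ofReal_sub_mul_I_ne_zero hr s))]

lemma map_sq_gaussianReal :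
    (gaussianReal 0 1).map (fun x ↦ x ^ 2) = gammaMeasure (1 / 2) (1 / 2) := by
  have := isProbabilityMeasure_gammaMeasure one_half_pos (one_half_pos (α := ℝ))
  have : IsProbabilityMeasure ((gaussianReal 0 1).map (fun x ↦ x ^ 2)) :=
    Measure.isProbabilityMeasure_map (by fun_prop)
  refine Measure.ext_of_charFun (funext fun s ↦ ?_)
  rw [charFun_map_sq_gaussianReal, charFun_gammaMeasure one_half_pos one_half_pos]

instance isProbabilityMeasure_chiSqMeasure (m : ℕ) : IsProbabilityMeasure (chiSqMeasure m) := by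
  unfold chiSqMeasure
  split_ifs with h
  · infer_instance
  · exact isProbabilityMeasure_gammaMeasure (by positivity) one_half_pos

lemma map_sq_gaussianReal_conv_chiSqMeasure (m : ℕ) :
    ((gaussianReal 0 1).map (fun x ↦ x ^ 2)).conv (chiSqMeasure m) = chiSqMeasure (m + 1) := by
  rw [map_sq_gaussianReal]
  have := isProbabilityMeasure_gammaMeasure one_half_pos (one_half_pos (α := ℝ))
  rcases m.eq_zero_or_pos with rfl | hm
  · rw [chiSqMeasure, if_pos rfl, Measure.conv_dirac_zero]
    simp [chiSqMeasure]
  · rw [chiSqMeasure, chiSqMeasure, if_neg hm.ne', if_neg m.succ_ne_zero,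
      gammaMeasure_conv_gammaMeasure one_half_pos (by positivity) one_half_pos]
    push_cast
    ring_nf

lemma map_sum_sq_pi_zero (μ : Measure ℝ) :
    (Measure.pi fun _ : Fin 0 ↦ μ).map (fun z ↦ ∑ i, z i ^ 2) = Measure.dirac 0 := by
  rw [Measure.pi_of_empty, Measure.map_dirac' (by fun_prop)]
  simp

lemma map_sum_sq_pi_succ (μ : Measure ℝ) [SigmaFinite μ] (n : ℕ) :
    (Measure.pi fun _ : Fin (n + 1) ↦ μ).map (fun z ↦ ∑ i, z i ^ 2) =
      (μ.map (fun x ↦ x ^ 2)).conv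
        ((Measure.pi fun _ : Fin n ↦ μ).map (fun z ↦ ∑ i, z i ^ 2)) := by
  rw [Measure.conv, Measure.map_prod_map _ _ (by fun_prop) (by fun_prop),
    Measure.map_map (by fun_prop) (by fun_prop),
    ← (measurePreserving_piFinSuccAbove (fun _ : Fin (n + 1) ↦ μ) 0).map_eq,
    Measure.map_map (by fun_prop) (MeasurableEquiv.measurable _)]
  congr 1
  ext z
  simp [Fin.sum_univ_succ, Fin.tail]

/-- First-order expansion of the convolution powers `L n` of a mixture `a • P + b • R`, where
`p n` are the convolution powers of `P`. -/
lemma exists_conv_pow_mixture_expansion {P R : Measure ℝ} [IsProbabilityMeasure P]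
    [IsProbabilityMeasure R] {p L : ℕ → Measure ℝ} [∀ n, IsProbabilityMeasure (p n)]
    (hp0 : p 0 = Measure.dirac 0) (hp : ∀ n, P.conv (p n) = p (n + 1)) {a b : ENNReal}
    (hab : a + b = 1) (hL0 : L 0 = Measure.dirac 0)
    (hL : ∀ n, L (n + 1) = (a • P + b • R).conv (L n)) (n : ℕ) :
    ∃ M : Measure ℝ, M Set.univ ≤ (n : ENNReal) ^ 2 ∧
      L (n + 1) = a ^ (n + 1) • p (n + 1) + ((n + 1 : ENNReal) * a ^ n * b) • R.conv (p n)
        + b ^ 2 • M := by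
  have ha : a ≤ 1 := hab ▸ le_self_add
  have hb : b ≤ 1 := hab ▸ le_add_self
  have hPR (ρ : Measure ℝ) [IsProbabilityMeasure ρ] :
      P.conv (R.conv ρ) = R.conv (P.conv ρ) := by
    rw [← Measure.conv_assoc, Measure.conv_comm P R, Measure.conv_assoc]
  have hmass (μ ρ : Measure ℝ) [SFinite μ] [SFinite ρ] :
      (μ.conv ρ) Set.univ = μ Set.univ * ρ Set.univ := by
    rw [Measure.conv, Measure.map_apply (by fun_prop) .univ, Set.preimage_univ,
      Measure.prod_apply .univ]
    simp [mul_comm]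
  induction n with
  | zero =>
    refine ⟨0, by simp, ?_⟩
    rw [hL, hL0, ← hp0, Measure.add_conv, Measure.conv_smul_left, Measure.conv_smul_left, hp]
    simp
  | succ n ih =>
    obtain ⟨M, hM, hLM⟩ := ih
    have : IsFiniteMeasure M := ⟨hM.trans_lt (by simp)⟩
    refine ⟨((n + 1 : ENNReal) * a ^ n) • R.conv (R.conv (p n)) +
      (a • P.conv M + b • R.conv M), ?_, ?_⟩
    · simp only [Measure.add_apply, Measure.smul_apply, hmass, measure_univ, smul_eq_mul, one_mul,
        mul_one, ← add_mul, hab]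
      calc (n + 1 : ENNReal) * a ^ n + M Set.univ ≤ (n + 1) * 1 + n ^ 2 := by
            gcongr
            exact pow_le_one₀ zero_le ha
        _ ≤ (n + 1) * 1 + n ^ 2 + n := le_self_add
        _ = ((n + 1 : ℕ) : ENNReal) ^ 2 := by push_cast; ring
    · rw [hL, hLM]
      simp only [Measure.add_conv, Measure.conv_add, Measure.conv_smul_left,
        Measure.conv_smul_right, hPR, hp]
      push_cast
      module

lemma map_sq_conv_apply_Ioi_toReal
    {μ ρ : Measure ℝ} [IsProbabilityMeasure μ] [IsProbabilityMeasure ρ]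
    (t : ℝ) :
    (((μ.map (fun x ↦ x ^ 2)).conv ρ) (Set.Ioi t)).toReal =
      ∫ x, (ρ (Set.Ioi (t - x ^ 2))).toReal ∂μ := by
  have hm : Measurable fun y ↦ ρ (Set.Ioi (t - y)) :=
    Monotone.measurable fun _ _ h ↦ measure_mono (Set.Ioi_subset_Ioi (sub_le_sub_left h t))
  have hm' : Measurable fun x ↦ ρ (Set.Ioi (t - x ^ 2)) := hm.comp (measurable_id.pow_const 2)
  rw [integral_toReal hm'.aemeasurable (by simp), Measure.conv,
    Measure.map_apply (by fun_prop) measurableSet_Ioi,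
    Measure.prod_apply (measurable_add measurableSet_Ioi), lintegral_map _ (by fun_prop)]
  · congr! 4 with x
    ext y
    simp [sub_lt_iff_lt_add']
  · exact measurable_measure_prodMk_left (measurable_add measurableSet_Ioi)

lemma hasDerivWithinAt_of_sq_expansion {h : ℝ → ℝ} {n : ℕ} {A B C : ℝ}
    (hbound : ∀ ε ∈ Set.Icc (0 : ℝ) 1,
      |h ε - ((1 - ε) ^ (n + 1) * A + (n + 1) * (1 - ε) ^ n * ε * B)| ≤ C * ε ^ 2) :
    HasDerivWithinAt h ((n + 1) * B - (n + 1) * A) (Set.Icc 0 1) 0 := by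
  set q : ℝ → ℝ := fun ε ↦ (1 - ε) ^ (n + 1) * A + (n + 1) * (1 - ε) ^ n * ε * B
  have hq : HasDerivAt q ((n + 1) * B - (n + 1) * A) 0 := by
    have h1 : HasDerivAt (fun ε : ℝ ↦ 1 - ε) (-1) 0 := (hasDerivAt_id 0).const_sub 1
    refine (((h1.fun_pow (n + 1)).mul_const A).fun_add
      ((((h1.fun_pow n).const_mul (n + 1 : ℝ)).fun_mul (hasDerivAt_id' 0)).mul_const
        B)).congr_deriv ?_
    simp
    ring
  have hr : HasDerivWithinAt (fun ε ↦ h ε - q ε) 0 (Set.Icc 0 1) 0 := by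
    have hO : (fun ε ↦ h ε - q ε) =O[nhdsWithin 0 (Set.Icc 0 1)] fun ε ↦ ‖ε - 0‖ ^ 2 := by
      refine Asymptotics.IsBigO.of_bound C ?_
      filter_upwards [self_mem_nhdsWithin] with ε hε
      simpa using hbound ε hε
    have := (hO.hasFDerivWithinAt (by simp) (by norm_num)).hasDerivWithinAt
    simpa using this
  simpa [Pi.add_def] using hr.add hq.hasDerivWithinAt

lemma hasDerivWithinAt_contaminated_tail (n : ℕ) (v : NNReal) (t : ℝ) :
    HasDerivWithinAt
      (fun ε : ℝ ↦
        ((Measure.pi fun _ : Fin (n + 1) ↦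
            (ENNReal.ofReal (1 - ε) • gaussianReal 0 1 + ENNReal.ofReal ε • gaussianReal 0 v))
          {z | t < ∑ i, (z i) ^ 2}).toReal)
      (((n + 1 : ℕ) : ℝ) * (∫ x, ((chiSqMeasure n) (Set.Ioi (t - x ^ 2))).toReal
            ∂(gaussianReal 0 v))
        - ((n + 1 : ℕ) : ℝ) * ((chiSqMeasure (n + 1)) (Set.Ioi t)).toReal)
      (Set.Icc 0 1) 0 := by
  rw [← map_sq_conv_apply_Ioi_toReal]
  have : IsProbabilityMeasure ((gaussianReal 0 1).map (fun x ↦ x ^ 2)) :=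
    Measure.isProbabilityMeasure_map (by fun_prop)
  have : IsProbabilityMeasure ((gaussianReal 0 v).map (fun x ↦ x ^ 2)) :=
    Measure.isProbabilityMeasure_map (by fun_prop)
  push_cast
  refine hasDerivWithinAt_of_sq_expansion (C := (n : ℝ) ^ 2) fun ε hε ↦ ?_
  set F := ENNReal.ofReal (1 - ε) • gaussianReal 0 1 + ENNReal.ofReal ε • (gaussianReal 0 v)
  have hε' : 0 ≤ 1 - ε := sub_nonneg.2 hε.2
  have hab : ENNReal.ofReal (1 - ε) + ENNReal.ofReal ε = 1 := by
    rw [← ENNReal.ofReal_add hε' hε.1]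
    simp
  have : IsProbabilityMeasure F := ⟨by simp [F, hab]⟩
  have hF : F.map (fun x ↦ x ^ 2) =
      ENNReal.ofReal (1 - ε) • (gaussianReal 0 1).map (fun x ↦ x ^ 2)
      + ENNReal.ofReal ε • (gaussianReal 0 v).map (fun x ↦ x ^ 2) := by
    rw [Measure.map_add _ _ (by fun_prop), Measure.map_smul, Measure.map_smul]
  obtain ⟨M, hM, hexp⟩ := exists_conv_pow_mixture_expansion (p := chiSqMeasure)
    (R := (gaussianReal 0 v).map (fun x ↦ x ^ 2))
    (L := fun n ↦ (Measure.pi fun _ : Fin n ↦ F).map (fun z ↦ ∑ i, z i ^ 2))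
    (by simp [chiSqMeasure]) map_sq_gaussianReal_conv_chiSqMeasure hab (map_sum_sq_pi_zero F)
    (fun m ↦ by rw [map_sum_sq_pi_succ, hF]) n
  have hMt : M (Set.Ioi t) ≤ (n : ENNReal) ^ 2 := (measure_mono (Set.subset_univ _)).trans hM
  have hMtop : M (Set.Ioi t) ≠ ⊤ := (hMt.trans_lt (by simp)).ne
  have hMreal : (M (Set.Ioi t)).toReal ≤ (n : ℝ) ^ 2 := by
    simpa using ENNReal.toReal_mono (by simp) hMt
  have hset : (Measure.pi fun _ : Fin (n + 1) ↦ F) {z | t < ∑ i, z i ^ 2} =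
      ((Measure.pi fun _ : Fin (n + 1) ↦ F).map (fun z ↦ ∑ i, z i ^ 2)) (Set.Ioi t) := by
    rw [Measure.map_apply (by fun_prop) measurableSet_Ioi]
    rfl
  have hn : ((n : ENNReal) + 1).toReal = n + 1 := by
    rw [ENNReal.toReal_add (by simp) (by simp)]
    simp
  rw [hset, hexp, Measure.add_apply, Measure.add_apply, Measure.smul_apply, Measure.smul_apply,
    Measure.smul_apply, smul_eq_mul, smul_eq_mul, smul_eq_mul, ENNReal.toReal_add (by finiteness)
    (by finiteness), ENNReal.toReal_add (by finiteness) (by finiteness)]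
  simp only [ENNReal.toReal_mul, ENNReal.toReal_pow, hn, ENNReal.toReal_ofReal hε',
    ENNReal.toReal_ofReal hε.1, add_sub_cancel_left]
  rw [abs_of_nonneg (by positivity), mul_comm]
  gcongr

theorem stmt3 (g : ℕ) (hg : 1 ≤ g) (ν t : ℝ) (hν : 0 < ν) :
    HasDerivWithinAt
      (fun ε : ℝ =>
        ((Measure.pi fun _ : Fin g =>
            (ENNReal.ofReal (1 - ε) • gaussianReal 0 1
              + ENNReal.ofReal ε • gaussianReal 0 ⟨ν ^ 2, sq_nonneg ν⟩))
          {z | t < ∑ i, (z i) ^ 2}).toReal)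
      ((g : ℝ) * (∫ x, ((chiSqMeasure (g - 1)) (Set.Ioi (t - x ^ 2))).toReal
            ∂(gaussianReal 0 ⟨ν ^ 2, sq_nonneg ν⟩))
        - (g : ℝ) * ((chiSqMeasure g) (Set.Ioi t)).toReal)
      (Set.Icc 0 1) 0 := by
  obtain ⟨n, rfl⟩ : ∃ n, g = n + 1 := ⟨g - 1, by omega⟩
  exact hasDerivWithinAt_contaminated_tail n ⟨ν ^ 2, sq_nonneg ν⟩ t
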